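/- arXiv:2312.13257 — 3 statements merged into one kernel-verified Lean document; each statement's English description precedes it below -/
import Mathlib

section
/- Under Assumptions 1, 2 and 3, for each λ > 0 let α²(λ) be the (squared) first component of the unique solution to the nonlinear system of equations with loss ρ_λ(·) = λ²ρ(·/λ). Then the map λ ↦ α²(λ) is locally 1/2-Hölder continuous: for all 0 < λ_min < λ_max < ∞, sup over λ ≠ λ̃ in [λ_min, λ_max] of |α²(λ) − α²(λ̃)| / |λ − λ̃|^{1/2} is at most a finite constant C(λ_min, λ_max, ρ, F_ε, γ). -/
open MeasureTheory ProbabilityTheory Filter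

/-- The nonlinear system of equations for the scaled loss `ρ_λ = λ²ρ(·/λ)`, with
`Z ~ N(0,1)` and `W ~ F_ε` independent; `prox lam k` is the proximal map of `k·ρ_λ`. -/
noncomputable def scaledSystem (γ : ℝ) (Fε : Measure ℝ)
    (prox : ℝ → ℝ → ℝ → ℝ) (lam a k : ℝ) : Prop :=
  a ^ 2 * γ = ∫ q : ℝ × ℝ, ((a * q.1 + q.2) - prox lam k (a * q.1 + q.2)) ^ 2
      ∂((gaussianReal 0 1).prod Fε)
  ∧ a * γ = ∫ q : ℝ × ℝ, ((a * q.1 + q.2) - prox lam k (a * q.1 + q.2)) * q.1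
      ∂((gaussianReal 0 1).prod Fε)


/-- the derivative of the loss vanishes at zero and is monotone. -/
lemma psi_zero (ρ : ℝ → ℝ) (hρmin : ∀ x : ℝ, x ≠ 0 → ρ 0 < ρ x) : deriv ρ 0 = 0 := by
  apply IsLocalMin.deriv_eq_zero
  refine Filter.Eventually.of_forall fun x => ?_
  by_cases h : x = 0
  · simp [h]
  · exact (hρmin x h).le

lemma psi_mono (ρ : ℝ → ℝ) (hρconv : ConvexOn ℝ Set.univ ρ) (hρdiff : Differentiable ℝ ρ) :
    Monotone (deriv ρ) := by
  have := hρconv.monotoneOn_deriv (fun x _ => hρdiff x)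
  exact monotoneOn_univ.mp this

lemma mono_prod {ψ : ℝ → ℝ} (h : Monotone ψ) (s t : ℝ) : 0 ≤ (ψ s - ψ t) * (s - t) := by
  rcases le_total s t with hst | hst
  · exact mul_nonneg_of_nonpos_of_nonpos (sub_nonpos.2 (h hst)) (sub_nonpos.2 hst)
  · exact mul_nonneg (sub_nonneg.2 (h hst)) (sub_nonneg.2 hst)

/-- strong monotonicity near zero. -/
lemma psi_strong (ψ : ℝ → ℝ) (M η : ℝ) (h0 : ψ 0 = 0) (hlip : LipschitzWith 1 ψ)
    (hη : 0 < η)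
    (hψη : ∀ᵐ x : ℝ ∂volume, η ≤ (ψ x) ^ 2 / M ^ 2 + deriv ψ x) (hM : 0 ≤ M) :
    ∃ c > 0, ∃ δ > 0, ∀ s t : ℝ, |s| ≤ 2 * δ → |t| ≤ 2 * δ →
      c * (s - t) ^ 2 ≤ (ψ s - ψ t) * (s - t) := by
  have key : ∃ δ > 0, ∀ x : ℝ, |x| ≤ 2 * δ → (ψ x) ^ 2 / M ^ 2 ≤ η / 2 := by
    rcases hM.eq_or_lt with h | h
    · refine ⟨1, one_pos, fun x _ => ?_⟩
      simp [← h]; positivity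
    · have hc : Continuous fun x => (ψ x) ^ 2 / M ^ 2 :=
        (hlip.continuous.pow 2).div_const _
      have h00 : (ψ 0) ^ 2 / M ^ 2 < η / 2 := by rw [h0]; simp; positivity
      have := (hc.tendsto 0).eventually (gt_mem_nhds h00)
      obtain ⟨ε, hε, hh⟩ := Metric.eventually_nhds_iff.1 this
      refine ⟨ε / 4, by positivity, fun x hx => (hh ?_).le⟩
      simp only [dist_zero_right, Real.norm_eq_abs]
      linarith
  obtain ⟨δ, hδ, hd⟩ := key
  have main : ∀ s t : ℝ, |s| ≤ 2 * δ → |t| ≤ 2 * δ → s ≤ t → η / 2 * (t - s) ≤ ψ t - ψ s := by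
    intro s t hs ht hst
    have hac : AbsolutelyContinuousOnInterval ψ s t :=
      (hlip.lipschitzOnWith (s := Set.uIcc s t)).absolutelyContinuousOnInterval
    rw [← hac.integral_deriv_eq_sub]
    have : ∫ x in s..t, (η / 2 : ℝ) ≤ ∫ x in s..t, deriv ψ x := by
      apply intervalIntegral.integral_mono_ae_restrict hst (by simp) hac.intervalIntegrable_deriv
      have := ae_restrict_of_ae (s := Set.Icc s t) hψη
      filter_upwards [this, ae_restrict_mem measurableSet_Icc] with x hx hx2
      have : |x| ≤ 2 * δ := by
        rw [abs_le] at *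
        exact ⟨hs.1.trans hx2.1, hx2.2.trans ht.2⟩
      linarith [hd x this]
    rw [intervalIntegral.integral_const, smul_eq_mul] at this
    linarith
  refine ⟨η / 2, by positivity, δ, hδ, fun s t hs ht => ?_⟩
  rcases le_total s t with hst | hst
  · nlinarith [main s t hs ht hst]
  · nlinarith [main t s ht hs hst]

/-- scaled version with saturation -/
lemma psi_scaled (ψ : ℝ → ℝ) (hm : Monotone ψ) (c δ : ℝ) (hc : 0 < c) (hδ : 0 < δ)
    (h : ∀ s t : ℝ, |s| ≤ 2 * δ → |t| ≤ 2 * δ → c * (s - t) ^ 2 ≤ (ψ s - ψ t) * (s - t))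
    (l₀ l : ℝ) (hl₀ : 0 < l₀) (hl : l₀ ≤ l) (s t : ℝ) (hs : |s| ≤ δ * l₀) :
    c * (min |s - t| (δ * l₀) * |s - t|) ≤ (l * ψ (s / l) - l * ψ (t / l)) * (s - t) := by
  have hl' : 0 < l := hl₀.trans_le hl
  have hmono : Monotone fun x => l * ψ (x / l) := by
    intro x y hxy
    exact mul_le_mul_of_nonneg_left (hm (div_le_div_of_nonneg_right hxy hl'.le)) hl'.le
  have h2 : ∀ s t : ℝ, |s| ≤ 2 * (δ * l₀) → |t| ≤ 2 * (δ * l₀) →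
      c * (s - t) ^ 2 ≤ (l * ψ (s / l) - l * ψ (t / l)) * (s - t) := by
    intro s t hs ht
    have aux : ∀ s : ℝ, |s| ≤ 2 * (δ * l₀) → |s / l| ≤ 2 * δ := by
      intro s hs
      rw [abs_div, abs_of_pos hl', div_le_iff₀ hl']
      nlinarith
    have := h (s / l) (t / l) (aux s hs) (aux t ht)
    have e1 : c * (s - t) ^ 2 = l ^ 2 * (c * (s / l - t / l) ^ 2) := by field_simp
    have e2 : (l * ψ (s / l) - l * ψ (t / l)) * (s - t)
      = l ^ 2 * ((ψ (s / l) - ψ (t / l)) * (s / l - t / l)) := by field_simp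
    rw [e1, e2]
    exact mul_le_mul_of_nonneg_left this (by positivity)
  have hD : 0 < δ * l₀ := by positivity
  generalize δ * l₀ = D at *
  have hs' := abs_le.1 hs
  by_cases ht : |t| ≤ 2 * D
  · refine le_trans ?_ (h2 s t (by linarith) ht)
    rw [← sq_abs (s - t), sq]
    gcongr
    exact min_le_left _ _
  · have hmin : min |s - t| D ≤ D := min_le_right _ _
    have hle : c * (min |s - t| D * |s - t|) ≤ c * (D * |s - t|) := by gcongr
    refine hle.trans ?_
    rw [not_le, lt_abs] at ht
    rcases ht with ht | ht
    · have h3 := h2 s (s + D) (by linarith) (by rw [abs_le]; constructor <;> linarith)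
      have h4 : l * ψ ((s + D) / l) ≤ l * ψ (t / l) := hmono (show s + D ≤ t by linarith [hs'.2])
      rw [abs_of_neg (by linarith [hs'.2] : s - t < 0)]
      have h5 : c * D ≤ l * ψ ((s + D) / l) - l * ψ (s / l) := by
        by_contra hcon
        nlinarith
      nlinarith [hs'.2]
    · have h3 := h2 s (s - D) (by linarith) (by rw [abs_le]; constructor <;> linarith)
      have h4 : l * ψ (t / l) ≤ l * ψ ((s - D) / l) := hmono (show t ≤ s - D by linarith [hs'.1])
      rw [abs_of_pos (by linarith [hs'.1] : 0 < s - t)]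
      have h5 : c * D ≤ l * ψ (s / l) - l * ψ ((s - D) / l) := by
        by_contra hcon
        nlinarith
      nlinarith [hs'.1]

/-- elementary pointwise inequality -/
lemma ptwise (δ d a r τ w : ℝ) (hδ : 0 < δ) (hd : 0 ≤ d) (hτ : 0 ≤ τ) (hτ1 : τ ≤ 1)
    (hw0 : 0 ≤ w) (hw : w ≤ δ) (hwa : w ≤ τ * a) (ha : a ≤ d + r) :
    w ^ 2 / 2 - τ ^ 2 * r ^ 2 ≤ τ * (min d δ * d) := by
  have hx : 0 ≤ τ * d := by positivity
  have h1 : w ≤ τ * d + τ * r := by nlinarith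
  have h2 : w ^ 2 ≤ 2 * (τ * d) ^ 2 + 2 * (τ * r) ^ 2 := by nlinarith [sq_nonneg (τ * d - τ * r)]
  rcases le_total d δ with h | h
  · rw [min_eq_left h]
    have : (τ * d) ^ 2 ≤ τ * (d * d) := by
      have : τ * τ ≤ τ := by nlinarith
      nlinarith [mul_nonneg hd hd]
    nlinarith
  · rw [min_eq_right h]
    rcases le_total (τ * d) δ with h' | h'
    · nlinarith
    · nlinarith [sq_nonneg (τ * r)]

/-- stationarity and nonexpansiveness of the prox -/
lemma prox_stat (ρ : ℝ → ℝ) (hρdiff : Differentiable ℝ ρ) (l k x p : ℝ) (hl : 0 < l)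
    (h : ∀ v : ℝ, (x - p) ^ 2 / 2 + k * (l ^ 2 * ρ (p / l))
        ≤ (x - v) ^ 2 / 2 + k * (l ^ 2 * ρ (v / l))) :
    x - p = k * (l * deriv ρ (p / l)) := by
  have hmin : IsLocalMin (fun v => (x - v) ^ 2 / 2 + k * (l ^ 2 * ρ (v / l))) p :=
    Filter.Eventually.of_forall h
  have h1 : HasDerivAt (fun v : ℝ => ρ (v / l)) (deriv ρ (p / l) * (1 / l)) p :=
    ((hρdiff (p / l)).hasDerivAt).comp p ((hasDerivAt_id p).div_const l)
  have h2 : HasDerivAt (fun v : ℝ => (x - v) ^ 2 / 2) (-(x - p)) p := by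
    have := (((hasDerivAt_id p).const_sub x).pow 2).div_const 2
    refine this.congr_deriv ?_
    simp only [id]
    ring
  have h3 := h2.add ((h1.const_mul (l ^ 2)).const_mul k)
  have := hmin.hasDerivAt_eq_zero h3
  field_simp at this
  linarith

lemma prox_cont (ψ : ℝ → ℝ) (hm : Monotone ψ) (l k : ℝ) (hl : 0 < l) (hk : 0 < k) (p : ℝ → ℝ)
    (h : ∀ x, x - p x = k * (l * ψ (p x / l))) : Continuous p := by
  have hL : LipschitzWith 1 p := by
    apply LipschitzWith.of_dist_le_mul
    intro x y
    simp only [Real.dist_eq, NNReal.coe_one, one_mul]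
    have hmono : Monotone fun x => k * (l * ψ (x / l)) := by
      intro x y hxy
      have := (hm (div_le_div_of_nonneg_right hxy hl.le))
      simp only; gcongr
    have := mono_prod hmono (p x) (p y)
    simp only [← h] at this
    apply abs_le_of_sq_le_sq' ?_ (abs_nonneg _) |> abs_le.2
    rw [sq_abs]
    nlinarith [sq_nonneg (x - y - (p x - p y))]
  exact hL.continuous

lemma openPos_conv (F G : Measure ℝ) [IsProbabilityMeasure F] [IsProbabilityMeasure G]
    (φ : ℝ → ℝ) (hφ : Continuous φ)
    (hF : F = volume.withDensity (fun z => ENNReal.ofReal (Real.exp (-φ z)))) :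
    (Measure.map (fun q : ℝ × ℝ => q.1 + q.2) (F.prod G)).IsOpenPosMeasure := by
  have hac : (volume : Measure ℝ) ≪ F := by
    rw [hF]
    apply withDensity_absolutelyContinuous'
    · fun_prop
    · exact Eventually.of_forall fun x => by positivity
  have hFpos : F.IsOpenPosMeasure := hac.isOpenPosMeasure
  refine ⟨fun U hU hne => ?_⟩
  have hmeas : Measurable fun q : ℝ × ℝ => q.1 + q.2 := by fun_prop
  rw [Measure.map_apply hmeas hU.measurableSet, Measure.prod_apply_symm (hmeas hU.measurableSet)]
  intro h0
  rw [lintegral_eq_zero_iff (measurable_measure_prodMk_right (hmeas hU.measurableSet))] at h0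
  obtain ⟨y, hy⟩ := h0.exists
  obtain ⟨x, hx⟩ := hne
  refine IsOpen.measure_ne_zero F ?_ ?_ hy
  · exact hU.preimage (by fun_prop : Continuous fun x : ℝ => x + y)
  · exact ⟨x - y, by simpa using hx⟩

/-- Hilbert-space description of a solution: `u = prox(aZ+W) - W`. -/
structure IsSol (P : Measure (ℝ × ℝ)) (γ : ℝ) (ψ : ℝ → ℝ) (l a k : ℝ) (u : ℝ × ℝ → ℝ) :
    Prop where
  hl : 0 < l
  ha : 0 < a
  hk : 0 < k
  mem : MemLp u 2 P
  hu2 : ∫ q, u q ^ 2 ∂P = a ^ 2 * (1 - γ)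
  huZ : ∫ q, u q * q.1 ∂P = a * (1 - γ)
  hfix : ∀ q, k * (l * ψ ((q.2 + u q) / l)) = a * q.1 - u q
  hp : ∀ q, |q.2 + u q| ≤ |a * q.1 + q.2|

lemma isSol_of_system (γ : ℝ) (ρ : ℝ → ℝ) (M : ℝ)
    (hρconv : ConvexOn ℝ Set.univ ρ) (hρdiff : Differentiable ℝ ρ)
    (hρmin : ∀ x : ℝ, x ≠ 0 → ρ 0 < ρ x)
    (hψbdd : ∀ x : ℝ, |deriv ρ x| ≤ M)
    (Fε : Measure ℝ) [IsProbabilityMeasure Fε] (p : ℝ → ℝ) (l a k : ℝ)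
    (hl : 0 < l) (ha : 0 < a) (hk : 0 < k)
    (hZ : MemLp (fun q : ℝ × ℝ => q.1) 2 ((gaussianReal 0 1).prod Fε))
    (hZ2 : ∫ q : ℝ × ℝ, q.1 ^ 2 ∂((gaussianReal 0 1).prod Fε) = 1)
    (hprox : ∀ x v : ℝ, (x - p x) ^ 2 / 2 + k * (l ^ 2 * ρ (p x / l))
        ≤ (x - v) ^ 2 / 2 + k * (l ^ 2 * ρ (v / l)))
    (h1 : a ^ 2 * γ = ∫ q : ℝ × ℝ, ((a * q.1 + q.2) - p (a * q.1 + q.2)) ^ 2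
      ∂((gaussianReal 0 1).prod Fε))
    (h2 : a * γ = ∫ q : ℝ × ℝ, ((a * q.1 + q.2) - p (a * q.1 + q.2)) * q.1
      ∂((gaussianReal 0 1).prod Fε)) :
    IsSol ((gaussianReal 0 1).prod Fε) γ (deriv ρ) l a k
      (fun q => p (a * q.1 + q.2) - q.2) := by
  have hm := psi_mono ρ hρconv hρdiff
  have h0 := psi_zero ρ hρmin
  have hst : ∀ x, x - p x = k * (l * deriv ρ (p x / l)) :=
    fun x => prox_stat ρ hρdiff l k x (p x) hl (hprox x)
  have hc : Continuous p := prox_cont _ hm l k hl hk p hst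
  set P := (gaussianReal 0 1).prod Fε with hP
  have hg : MemLp (fun q : ℝ × ℝ => (a * q.1 + q.2) - p (a * q.1 + q.2)) 2 P := by
    apply MemLp.of_bound (C := k * (l * M))
    · exact (by fun_prop : Continuous _).aestronglyMeasurable
    · refine Eventually.of_forall fun q => ?_
      rw [hst, Real.norm_eq_abs, abs_mul, abs_mul, abs_of_pos hl, abs_of_pos hk]
      gcongr
      exact hψbdd _
  have hu : (fun q : ℝ × ℝ => p (a * q.1 + q.2) - q.2) =
      fun q => a * q.1 - ((a * q.1 + q.2) - p (a * q.1 + q.2)) := by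
    funext q; ring
  have i1 : Integrable (fun q : ℝ × ℝ => q.1 ^ 2) P := hZ.integrable_sq
  have i2 : Integrable (fun q : ℝ × ℝ => ((a * q.1 + q.2) - p (a * q.1 + q.2)) ^ 2) P :=
    hg.integrable_sq
  have i3 : Integrable (fun q : ℝ × ℝ => ((a * q.1 + q.2) - p (a * q.1 + q.2)) * q.1) P :=
    hg.integrable_mul hZ
  refine ⟨hl, ha, hk, ?_, ?_, ?_, ?_, ?_⟩
  · rw [hu]; exact (hZ.const_mul a).sub hg
  · have e : (fun q : ℝ × ℝ => (p (a * q.1 + q.2) - q.2) ^ 2) = fun q =>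
        (a ^ 2 * q.1 ^ 2 + (-2 * a) * (((a * q.1 + q.2) - p (a * q.1 + q.2)) * q.1))
        + ((a * q.1 + q.2) - p (a * q.1 + q.2)) ^ 2 := by
      funext q; ring
    have j1 := i1.const_mul (a ^ 2)
    have j3 := i3.const_mul (-2 * a)
    rw [e]
    erw [integral_add (j1.add j3) i2, integral_add j1 j3]
    rw [integral_const_mul, integral_const_mul, ← h1, ← h2, hZ2]
    ring
  · have e : (fun q : ℝ × ℝ => (p (a * q.1 + q.2) - q.2) * q.1) = fun q =>
        a * q.1 ^ 2 - ((a * q.1 + q.2) - p (a * q.1 + q.2)) * q.1 := by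
      funext q; ring
    rw [e, integral_sub (i1.const_mul _) i3, integral_const_mul, ← h2, hZ2]
    ring
  · intro q
    have := hst (a * q.1 + q.2)
    simp only [add_sub_cancel]
    rw [← this]; ring
  · intro q
    simp only [add_sub_cancel]
    generalize a * q.1 + q.2 = x
    have h3 := hst x
    have h4 : 0 ≤ deriv ρ (p x / l) * (p x / l) := by
      simpa [h0] using mono_prod hm (p x / l) 0
    have h5 : 0 ≤ (x - p x) * p x := by
      rw [h3]
      have : k * (l * deriv ρ (p x / l)) * p x = k * l ^ 2 * (deriv ρ (p x / l) * (p x / l)) := by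
        field_simp
      rw [this]; positivity
    apply sq_le_sq.1
    nlinarith [sq_nonneg (x - p x)]

lemma IsSol.abs_le {P : Measure (ℝ × ℝ)} [IsProbabilityMeasure P] {γ : ℝ} {ψ : ℝ → ℝ}
    {l a k : ℝ} {u : ℝ × ℝ → ℝ} (h : IsSol P γ ψ l a k u) (hγ : 0 ≤ γ) :
    ∫ q, |u q| ∂P ≤ a := by
  have i1 : Integrable (fun q => |u q|) P := (h.mem.integrable (by norm_num)).abs
  have i2 : Integrable (fun q => u q ^ 2) P := h.mem.integrable_sq
  have : ∫ q, (2 * a) * |u q| ∂P ≤ ∫ q, (u q ^ 2 + a ^ 2) ∂P := by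
    apply integral_mono (i1.const_mul _) (i2.add (integrable_const _))
    intro q
    simp only [Pi.add_apply]
    nlinarith [sq_nonneg (|u q| - a), sq_abs (u q)]
  rw [integral_const_mul, integral_add i2 (integrable_const _), h.hu2, integral_const] at this
  simp at this
  have ha := h.ha
  by_contra hcon
  nlinarith [mul_nonneg (sq_nonneg a) hγ]

section pair
variable {P : Measure (ℝ × ℝ)} [IsProbabilityMeasure P] {γ : ℝ} {ψ : ℝ → ℝ}
    {l a k l' a' k' : ℝ} {u u' : ℝ × ℝ → ℝ}

/-- the nonnegative defect. -/
noncomputable def defect (P : Measure (ℝ × ℝ)) (γ a a' : ℝ) (u u' : ℝ × ℝ → ℝ) : ℝ :=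
  a * a' * (1 - γ) - ∫ q, u q * u' q ∂P

lemma int_r (h : IsSol P γ ψ l a k u) (h' : IsSol P γ ψ l' a' k' u') (t : ℝ) :
    ∫ q, (u' q - t * u q) ^ 2 ∂P =
      a' ^ 2 * (1 - γ) - 2 * t * (∫ q, u q * u' q ∂P) + t ^ 2 * (a ^ 2 * (1 - γ)) := by
  have i1 : Integrable (fun q => u q ^ 2) P := h.mem.integrable_sq
  have i2 : Integrable (fun q => u' q ^ 2) P := h'.mem.integrable_sq
  have i3 : Integrable (fun q => u q * u' q) P := h.mem.integrable_mul h'.mem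
  have e : (fun q => (u' q - t * u q) ^ 2) = fun q =>
      (u' q ^ 2 + (-2 * t) * (u q * u' q)) + t ^ 2 * u q ^ 2 := by funext q; ring
  have j1 := i1.const_mul (t ^ 2)
  have j3 := i3.const_mul (-2 * t)
  rw [e]
  erw [integral_add (i2.add j3) j1, integral_add i2 j3]
  rw [integral_const_mul, integral_const_mul, h.hu2, h'.hu2]
  ring

lemma int_r_defect (h : IsSol P γ ψ l a k u) (h' : IsSol P γ ψ l' a' k' u') :
    ∫ q, (u' q - a' / a * u q) ^ 2 ∂P = 2 * (a' / a) * defect P γ a a' u u' := by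
  have ha := h.ha
  rw [int_r h h', defect]
  field_simp
  ring

lemma int_diff (h : IsSol P γ ψ l a k u) (h' : IsSol P γ ψ l' a' k' u') :
    ∫ q, (u' q - u q) ^ 2 ∂P = (1 - γ) * (a - a') ^ 2 + 2 * defect P γ a a' u u' := by
  have := int_r h h' 1
  simp only [one_mul] at this
  rw [this, defect]
  ring

lemma defect_nonneg (h : IsSol P γ ψ l a k u) (h' : IsSol P γ ψ l' a' k' u') :
    0 ≤ defect P γ a a' u u' := by
  have h1 : 0 ≤ ∫ q, (u' q - a' / a * u q) ^ 2 ∂P := integral_nonneg fun q => sq_nonneg _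
  rw [int_r_defect h h'] at h1
  have : 0 < 2 * (a' / a) := by have := h.ha; have := h'.ha; positivity
  exact nonneg_of_mul_nonneg_right h1 this

/-- the upper function for the monotonicity term -/
noncomputable def upper (Ct l l' a a' k k' : ℝ) (u u' : ℝ × ℝ → ℝ) (q : ℝ × ℝ) : ℝ :=
  ((a * q.1 - u q) / k - (a' * q.1 - u' q) / k') * (u q - u' q)
    + Ct * |l - l'| * (|u q| + |u' q|)

lemma upper_int (hZ : MemLp (fun q : ℝ × ℝ => q.1) 2 P)
    (h : IsSol P γ ψ l a k u) (h' : IsSol P γ ψ l' a' k' u') (Ct : ℝ) :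
    Integrable (upper Ct l l' a a' k k' u u') P := by
  unfold upper
  refine Integrable.add ?_ ?_
  · refine MemLp.integrable_mul (p := 2) (q := 2) ?_ (h.mem.sub h'.mem)
    have m1 := ((hZ.const_mul a).sub h.mem).const_mul k⁻¹
    have m2 := ((hZ.const_mul a').sub h'.mem).const_mul k'⁻¹
    refine (m1.sub m2).ae_eq (Eventually.of_forall fun q => ?_)
    simp only [Pi.sub_apply]
    ring
  · exact ((h.mem.integrable (by norm_num)).abs.add
      (h'.mem.integrable (by norm_num)).abs).const_mul _

lemma upper_integral (hZ : MemLp (fun q : ℝ × ℝ => q.1) 2 P)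
    (h : IsSol P γ ψ l a k u) (h' : IsSol P γ ψ l' a' k' u') (Ct : ℝ) (hCt : 0 ≤ Ct)
    (hγ : 0 ≤ γ) :
    ∫ q, upper Ct l l' a a' k k' u u' q ∂P ≤
      -(1 / k + 1 / k') * defect P γ a a' u u' + Ct * |l - l'| * (a + a') := by
  have i1 : Integrable (fun q => u q ^ 2) P := h.mem.integrable_sq
  have i2 : Integrable (fun q => u' q ^ 2) P := h'.mem.integrable_sq
  have i3 : Integrable (fun q => u q * u' q) P := h.mem.integrable_mul h'.mem
  have i4 : Integrable (fun q => u q * q.1) P := h.mem.integrable_mul hZ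
  have i5 : Integrable (fun q => u' q * q.1) P := h'.mem.integrable_mul hZ
  have i6 : Integrable (fun q => |u q|) P := (h.mem.integrable (by norm_num)).abs
  have i7 : Integrable (fun q => |u' q|) P := (h'.mem.integrable (by norm_num)).abs
  have e : upper Ct l l' a a' k k' u u' = fun q =>
      (((((a / k - a' / k') * (u q * q.1) + (-(a / k - a' / k')) * (u' q * q.1))
      + (-(1 / k)) * u q ^ 2) + (-(1 / k')) * u' q ^ 2) + (1 / k + 1 / k') * (u q * u' q))
      + Ct * |l - l'| * (|u q| + |u' q|) := by
    funext q; unfold upper; ring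
  have j1 := (i4.const_mul (a / k - a' / k'))
  have j2 := (i5.const_mul (-(a / k - a' / k')))
  have j3 := i1.const_mul (-(1 / k))
  have j4 := i2.const_mul (-(1 / k'))
  have j5 := i3.const_mul (1 / k + 1 / k')
  have j6 := (i6.add i7).const_mul (Ct * |l - l'|)
  have s1 := j1.add j2
  have s2 := s1.add j3
  have s3 := s2.add j4
  have s4 := s3.add j5
  have hh := h.abs_le hγ
  have hh' := h'.abs_le hγ
  rw [e]
  erw [integral_add s4 j6, integral_add s3 j5, integral_add s2 j4, integral_add s1 j3,
    integral_add j1 j2]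
  simp only [integral_const_mul]
  rw [show ∫ q, (((fun q => |u q|) + fun q => |u' q|) : ℝ × ℝ → ℝ) q ∂P
      = (∫ q, |u q| ∂P) + ∫ q, |u' q| ∂P from integral_add i6 i7]
  rw [h.hu2, h'.hu2, h.huZ, h'.huZ, defect]
  have : Ct * |l - l'| * ((∫ q, |u q| ∂P) + ∫ q, |u' q| ∂P) ≤ Ct * |l - l'| * (a + a') := by
    gcongr
  have hk := h.hk
  have hk' := h'.hk
  refine le_trans (add_le_add_right this _) (le_of_eq ?_)
  field_simp
  ring

/-- the monotonicity term is below `upper`, pointwise. -/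
lemma le_upper (h : IsSol P γ ψ l a k u) (h' : IsSol P γ ψ l' a' k' u') (Ct : ℝ)
    (hCt : 0 ≤ Ct)
    (ht : ∀ x, |l * ψ (x / l) - l' * ψ (x / l')| ≤ Ct * |l - l'|) (q : ℝ × ℝ) :
    (l * ψ ((q.2 + u q) / l) - l * ψ ((q.2 + u' q) / l)) * ((q.2 + u q) - (q.2 + u' q)) ≤
      upper Ct l l' a a' k k' u u' q := by
  have hk := h.hk
  have hk' := h'.hk
  have e1 : (a * q.1 - u q) / k = l * ψ ((q.2 + u q) / l) := by
    rw [← h.hfix q]; field_simp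
  have e2 : (a' * q.1 - u' q) / k' = l' * ψ ((q.2 + u' q) / l') := by
    rw [← h'.hfix q]; field_simp
  unfold upper
  rw [e1, e2]
  have h3 := ht (q.2 + u' q)
  set x := l * ψ ((q.2 + u' q) / l)
  set y := l' * ψ ((q.2 + u' q) / l')
  have h4 : -((x - y) * (u q - u' q)) ≤ Ct * |l - l'| * (|u q| + |u' q|) := by
    refine (neg_le_abs _).trans ?_
    rw [abs_mul]
    exact mul_le_mul h3 (abs_sub _ _) (abs_nonneg _) (by positivity)
  nlinarith

lemma defect_le (hZ : MemLp (fun q : ℝ × ℝ => q.1) 2 P) (hm : Monotone ψ)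
    (h : IsSol P γ ψ l a k u) (h' : IsSol P γ ψ l' a' k' u') (Ct : ℝ) (hCt : 0 ≤ Ct)
    (hγ : 0 ≤ γ)
    (ht : ∀ x, |l * ψ (x / l) - l' * ψ (x / l')| ≤ Ct * |l - l'|) :
    defect P γ a a' u u' ≤ k * (Ct * |l - l'| * (a + a')) := by
  have hl := h.hl
  have hmono : Monotone fun x => l * ψ (x / l) := by
    intro x y hxy
    have := (hm (div_le_div_of_nonneg_right hxy hl.le))
    simp only; gcongr
  have h0 : 0 ≤ ∫ q, upper Ct l l' a a' k k' u u' q ∂P :=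
    integral_nonneg fun q => (mono_prod hmono _ _).trans (le_upper h h' Ct hCt ht q)
  have h1 := h0.trans (upper_integral hZ h h' Ct hCt hγ)
  have hD := defect_nonneg h h'
  have hk := h.hk
  have hk' : 0 < 1 / k' := by have := h'.hk; positivity
  have h2 : 1 / k * defect P γ a a' u u' ≤ Ct * |l - l'| * (a + a') := by
    nlinarith [mul_nonneg hk'.le hD]
  rw [one_div, inv_mul_le_iff₀ hk] at h2
  exact h2

/-- Main quantitative inequality. -/
lemma main_ineq (hZ : MemLp (fun q : ℝ × ℝ => q.1) 2 P) (hm : Monotone ψ)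
    (h : IsSol P γ ψ l a k u) (h' : IsSol P γ ψ l' a' k' u') (Ct : ℝ) (hCt : 0 ≤ Ct)
    (hγ : 0 ≤ γ)
    (ht : ∀ x, |l * ψ (x / l) - l' * ψ (x / l')| ≤ Ct * |l - l'|)
    (c δ : ℝ) (hc : 0 < c) (hδ : 0 < δ)
    (hs : ∀ s t, |s| ≤ δ →
      c * (min |s - t| δ * |s - t|) ≤ (l * ψ (s / l) - l * ψ (t / l)) * (s - t))
    (A : Set (ℝ × ℝ)) (hA : MeasurableSet A)
    (hA1 : ∀ q ∈ A, |a * q.1 + q.2| ≤ δ) (hA2 : ∀ q ∈ A, 2 * δ ≤ |q.2|) :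
    P.real A * (c * δ ^ 2 / 2) * ((a - a') / (a + a')) ^ 2 ≤
      Ct * |l - l'| * a * (1 + 2 * c * k) := by
  have ha := h.ha
  have ha' := h'.ha
  have hl := h.hl
  have hk := h.hk
  have hmono : Monotone fun x => l * ψ (x / l) := by
    intro x y hxy
    have := (hm (div_le_div_of_nonneg_right hxy hl.le))
    simp only; gcongr
  set t := a' / a with htdef
  set τ := a / (a + a') with hτdef
  set w := |a - a'| / (a + a') * δ with hwdef
  have htpos : 0 < t := by positivity
  have hτpos : 0 < τ := by positivity
  have hτ1 : τ ≤ 1 := by rw [hτdef, div_le_one (by positivity)]; linarith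
  have hτt : τ * t ≤ 1 := by
    rw [hτdef, htdef]
    have : a / (a + a') * (a' / a) = a' / (a + a') := by field_simp
    rw [this, div_le_one (by positivity)]; linarith
  have hw0 : 0 ≤ w := by positivity
  have hfrac : |a - a'| / (a + a') ≤ 1 := by
    rw [div_le_one (by positivity), abs_le]; constructor <;> linarith
  have hw1 : w ≤ δ := by
    rw [hwdef]; nlinarith
  have hpt : ∀ q, A.indicator (fun _ => c * (w ^ 2 / 2)) q
      + (-(c * τ ^ 2)) * (u' q - t * u q) ^ 2 ≤ τ * upper Ct l l' a a' k k' u u' q := by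
    intro q
    have hup := le_upper h h' Ct hCt ht q
    by_cases hq : q ∈ A
    · rw [Set.indicator_of_mem hq]
      have hp : |q.2 + u q| ≤ δ := (h.hp q).trans (hA1 q hq)
      have hu : δ ≤ |u q| := by
        have h1 := abs_sub (q.2 + u q) (u q)
        simp only [add_sub_cancel_right] at h1
        linarith [hA2 q hq]
      have h1 := hs (q.2 + u q) (q.2 + u' q) hp
      have h2 := ptwise δ (|q.2 + u q - (q.2 + u' q)|) (|1 - t| * |u q|) (|u' q - t * u q|) τ w
        hδ (abs_nonneg _) hτpos.le hτ1 hw0 hw1 ?_ ?_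
      · rw [sq_abs] at h2
        have h3 := mul_le_mul_of_nonneg_left (h1.trans hup) hτpos.le
        have h4 := mul_le_mul_of_nonneg_left h2 hc.le
        nlinarith
      · have : τ * (|1 - t| * |u q|) = |a - a'| / (a + a') * |u q| := by
          have : τ * |1 - t| = |a - a'| / (a + a') := by
            have e : 1 - t = (a - a') / a := by rw [htdef]; field_simp
            rw [e, abs_div, abs_of_pos ha, hτdef]
            field_simp
          rw [← mul_assoc, this]
        rw [this, hwdef]
        gcongr
      · rw [← abs_mul]
        have e : (1 - t) * u q = (q.2 + u q - (q.2 + u' q)) + (u' q - t * u q) := by ring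
        rw [e]
        exact abs_add_le _ _
    · rw [Set.indicator_of_notMem hq]
      have h1 := mul_nonneg hτpos.le ((mono_prod hmono _ _).trans hup)
      have h2 : 0 ≤ (c * τ ^ 2) * (u' q - t * u q) ^ 2 := by positivity
      linarith
  have ir : Integrable (fun q => (u' q - t * u q) ^ 2) P :=
    (h'.mem.sub (h.mem.const_mul t)).integrable_sq
  have iA : Integrable (A.indicator (fun _ : ℝ × ℝ => c * (w ^ 2 / 2))) P :=
    (integrable_const _).indicator hA
  have hint := integral_mono (iA.add (ir.const_mul (-(c * τ ^ 2))))
    ((upper_int hZ h h' Ct).const_mul τ) hpt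
  rw [integral_const_mul] at hint
  erw [integral_add iA (ir.const_mul _)] at hint
  rw [integral_const_mul, integral_indicator_const _ hA, int_r_defect h h', smul_eq_mul] at hint
  have hD := defect_nonneg h h'
  have hDle := defect_le hZ hm h h' Ct hCt hγ ht
  have hU := mul_le_mul_of_nonneg_left (upper_integral hZ h h' Ct hCt hγ) hτpos.le
  rw [← htdef] at hint
  set D := defect P γ a a' u u'
  have hkk : 0 ≤ 1 / k + 1 / k' := by have := h'.hk; positivity
  have e1 : τ * (a + a') = a := by rw [hτdef]; field_simp
  have h5 : P.real A * (c * (w ^ 2 / 2)) ≤ 2 * c * (τ * t) * (τ * D) + Ct * |l - l'| * a := by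
    have : 0 ≤ τ * ((1 / k + 1 / k') * D) := by positivity
    have e2 : Ct * |l - l'| * a = τ * (Ct * |l - l'| * (a + a')) := by
      linear_combination (-(Ct * |l - l'|)) * e1
    rw [e2]
    nlinarith
  have h6 : τ * D ≤ k * (Ct * |l - l'| * a) := by
    have := mul_le_mul_of_nonneg_left hDle hτpos.le
    have e2 : k * (Ct * |l - l'| * a) = τ * (k * (Ct * |l - l'| * (a + a'))) := by
      linear_combination (-(k * (Ct * |l - l'|))) * e1
    rwa [e2]
  have h7 : 2 * c * (τ * t) * (τ * D) ≤ 2 * c * 1 * (k * (Ct * |l - l'| * a)) := by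
    gcongr
  have e3 : P.real A * (c * δ ^ 2 / 2) * ((a - a') / (a + a')) ^ 2
      = P.real A * (c * (w ^ 2 / 2)) := by
    rw [hwdef, mul_pow, div_pow, div_pow, sq_abs]; ring
  rw [e3]
  linarith

/-- Comparison of the `κ` components. -/
lemma kappa_ineq (hZ : MemLp (fun q : ℝ × ℝ => q.1) 2 P)
    (hZ2 : ∫ q : ℝ × ℝ, q.1 ^ 2 ∂P = 1)
    (hlip : LipschitzWith 1 ψ)
    (h : IsSol P γ ψ l a k u) (h' : IsSol P γ ψ l' a' k' u') (Ct : ℝ)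
    (ht : ∀ x, |l * ψ (x / l) - l' * ψ (x / l')| ≤ Ct * |l - l'|) :
    a ^ 2 * γ / k ^ 2 ≤ 2 * (a' ^ 2 * γ / k' ^ 2) + 4 * (Ct * |l - l'|) ^ 2
      + 4 * ((1 - γ) * (a - a') ^ 2 + 2 * defect P γ a a' u u') := by
  have hE : ∀ {l a k : ℝ} {u : ℝ × ℝ → ℝ}, IsSol P γ ψ l a k u →
      ∫ q, ((a * q.1 - u q) / k) ^ 2 ∂P = a ^ 2 * γ / k ^ 2 ∧
      Integrable (fun q => ((a * q.1 - u q) / k) ^ 2) P := by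
    intro l a k u h
    have i1 : Integrable (fun q => u q ^ 2) P := h.mem.integrable_sq
    have i4 : Integrable (fun q => u q * q.1) P := h.mem.integrable_mul hZ
    have i0 : Integrable (fun q : ℝ × ℝ => q.1 ^ 2) P := hZ.integrable_sq
    have e : (fun q : ℝ × ℝ => ((a * q.1 - u q) / k) ^ 2) = fun q =>
        (a ^ 2 / k ^ 2 * q.1 ^ 2 + (-(2 * a) / k ^ 2) * (u q * q.1)) + 1 / k ^ 2 * u q ^ 2 := by
      funext q; ring
    have j1 := i0.const_mul (a ^ 2 / k ^ 2)
    have j2 := i4.const_mul (-(2 * a) / k ^ 2)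
    have j3 := i1.const_mul (1 / k ^ 2)
    rw [e]
    refine ⟨?_, (j1.add j2).add j3⟩
    erw [integral_add (j1.add j2) j3, integral_add j1 j2]
    simp only [integral_const_mul]
    rw [hZ2, h.huZ, h.hu2]
    ring
  obtain ⟨e1, i1⟩ := hE h
  obtain ⟨e2, i2⟩ := hE h'
  have i3 : Integrable (fun q => (u' q - u q) ^ 2) P := (h'.mem.sub h.mem).integrable_sq
  have hk := h.hk
  have hk' := h'.hk
  have hl := h.hl
  have hpt : ∀ q : ℝ × ℝ, ((a * q.1 - u q) / k) ^ 2 ≤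
      (2 * ((a' * q.1 - u' q) / k') ^ 2 + 4 * (u' q - u q) ^ 2) + 4 * (Ct * |l - l'|) ^ 2 := by
    intro q
    have e1 : (a * q.1 - u q) / k = l * ψ ((q.2 + u q) / l) := by
      rw [← h.hfix q]; field_simp
    have e2 : (a' * q.1 - u' q) / k' = l' * ψ ((q.2 + u' q) / l') := by
      rw [← h'.hfix q]; field_simp
    rw [e1, e2]
    have h3 := ht (q.2 + u' q)
    have h4 : |l * ψ ((q.2 + u q) / l) - l * ψ ((q.2 + u' q) / l)| ≤ |u' q - u q| := by
      have := hlip.dist_le_mul ((q.2 + u q) / l) ((q.2 + u' q) / l)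
      simp only [Real.dist_eq, NNReal.coe_one, one_mul] at this
      rw [← mul_sub, abs_mul, abs_of_pos hl]
      calc l * _ ≤ l * |(q.2 + u q) / l - (q.2 + u' q) / l| := by gcongr
        _ = |u' q - u q| := by
          rw [← sub_div, abs_div, abs_of_pos hl, abs_sub_comm]
          field_simp
          congr 1; ring
    set x := l * ψ ((q.2 + u q) / l)
    set y := l * ψ ((q.2 + u' q) / l)
    set z := l' * ψ ((q.2 + u' q) / l')
    have h5 : (y - z) ^ 2 ≤ (Ct * |l - l'|) ^ 2 := by
      rw [← sq_abs (y - z)]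
      gcongr
    have h6 : (x - y) ^ 2 ≤ (u' q - u q) ^ 2 := sq_le_sq.2 h4
    nlinarith [sq_nonneg (x - y - (y - z)), sq_nonneg (z - (x - z))]
  have hint := integral_mono i1
    (((i2.const_mul 2).add (i3.const_mul 4)).add (integrable_const (4 * (Ct * |l - l'|) ^ 2))) hpt
  erw [integral_add ((i2.const_mul 2).add (i3.const_mul 4)) (integrable_const _),
    integral_add (i2.const_mul 2) (i3.const_mul 4)] at hint
  rw [integral_const_mul, integral_const_mul, e1, e2, int_diff h h', integral_const] at hint
  simp only [probReal_univ, one_smul] at hint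
  linarith

end pair

/-- Under Assumptions 1, 2 and 3, the map `λ ↦ α²(λ)` given by the
unique solution of the nonlinear system with loss `ρ_λ` is locally `1/2`-Hölder
continuous on every interval `[λ_min, λ_max] ⊂ (0,∞)`. -/
theorem alpha_sq_locally_holder
    (γ : ℝ) (hγ : γ ∈ Set.Ioo (0:ℝ) 1)
    -- Assumption 1 (loss)
    (ρ : ℝ → ℝ) (Mψ η : ℝ)
    (hρconv : ConvexOn ℝ Set.univ ρ)
    (hρdiff : Differentiable ℝ ρ)
    (hρmin : ∀ x : ℝ, x ≠ 0 → ρ 0 < ρ x)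
    (hMψ : Mψ = ⨆ x : ℝ, |deriv ρ x|)
    (hψbdd : ∀ x : ℝ, |deriv ρ x| ≤ Mψ)
    (hψlip : LipschitzWith 1 (deriv ρ))
    (hη : 0 < η)
    (hψη : ∀ᵐ x : ℝ ∂volume, η ≤ (deriv ρ x) ^ 2 / Mψ ^ 2 + deriv (deriv ρ) x)
    -- Assumption 2 (noise distribution)
    (Fε F Ftilde : Measure ℝ) [IsProbabilityMeasure Fε]
    [IsProbabilityMeasure F] [IsProbabilityMeasure Ftilde]
    (φ : ℝ → ℝ)
    (hφC2 : ContDiff ℝ 2 φ)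
    (hφ'' : ∃ Cφ : ℝ, ∀ x : ℝ, |deriv (deriv φ) x| ≤ Cφ)
    (hF : F = volume.withDensity (fun z => ENNReal.ofReal (Real.exp (-φ z))))
    (hFconv : Fε = Measure.map (fun q : ℝ × ℝ => q.1 + q.2) (F.prod Ftilde))
    -- Assumption 3 (tuning)
    (htuning : ∃ Ct : ℝ, ∀ lam lam' x : ℝ, 0 < lam → 0 < lam' →
      |lam * deriv ρ (x / lam) - lam' * deriv ρ (x / lam')| ≤ Ct * |lam - lam'|)
    -- proximal maps of κ·ρ_λ
    (prox : ℝ → ℝ → ℝ → ℝ)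
    (hprox : ∀ lam k x : ℝ, 0 < lam → ∀ v : ℝ,
      (x - prox lam k x) ^ 2 / 2 + k * (lam ^ 2 * ρ (prox lam k x / lam))
        ≤ (x - v) ^ 2 / 2 + k * (lam ^ 2 * ρ (v / lam)))
    -- the solution map λ ↦ (α(λ), κ(λ)) of the system
    (alpha kappa : ℝ → ℝ)
    (halpha : ∀ lam : ℝ, 0 < lam → 0 < alpha lam ∧ 0 < kappa lam ∧
      scaledSystem γ Fε prox lam (alpha lam) (kappa lam)) :
    -- conclusion: local 1/2-Hölder continuity of λ ↦ α²(λ)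
    ∀ lamMin lamMax : ℝ, 0 < lamMin → lamMin < lamMax →
      ∃ C : ℝ, ∀ lam lam' : ℝ,
        lam ∈ Set.Icc lamMin lamMax → lam' ∈ Set.Icc lamMin lamMax →
        |(alpha lam) ^ 2 - (alpha lam') ^ 2| ≤ C * Real.sqrt |lam - lam'| := by
  intro lamMin lamMax hmin hlt
  obtain ⟨Ct0, hCt0⟩ := htuning
  obtain ⟨hγ0, hγ1⟩ := hγ
  have hm := psi_mono ρ hρconv hρdiff
  have h0 := psi_zero ρ hρmin
  have hM : 0 ≤ Mψ := (abs_nonneg _).trans (hψbdd 0)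
  obtain ⟨c, hc, δ0, hδ0, hstrong⟩ := psi_strong (deriv ρ) Mψ η h0 hψlip hη hψη hM
  obtain ⟨Ct, hCt, htun⟩ : ∃ Ct : ℝ, 0 ≤ Ct ∧ ∀ l l' : ℝ, 0 < l → 0 < l' → ∀ x,
      |l * deriv ρ (x / l) - l' * deriv ρ (x / l')| ≤ Ct * |l - l'| := by
    refine ⟨|Ct0|, abs_nonneg _, fun l l' hl hl' x => (hCt0 l l' x hl hl').trans ?_⟩
    gcongr
    exact le_abs_self _
  have hFpos : Fε.IsOpenPosMeasure := by
    rw [hFconv]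
    exact openPos_conv F Ftilde φ hφC2.continuous hF
  have hGpos : (gaussianReal 0 1).IsOpenPosMeasure :=
    (gaussianReal_absolutelyContinuous' 0 (by norm_num)).isOpenPosMeasure
  have hZ : MemLp (fun q : ℝ × ℝ => q.1) 2 ((gaussianReal 0 1).prod Fε) :=
    (memLp_id_gaussianReal' (μ := 0) (v := 1) 2 (by norm_num)).comp_fst Fε
  have hZ2 : ∫ q : ℝ × ℝ, q.1 ^ 2 ∂((gaussianReal 0 1).prod Fε) = 1 := by
    rw [integral_fun_fst (fun x : ℝ => x ^ 2)]
    have h1 := variance_of_integral_eq_zero (μ := gaussianReal 0 1) (X := id)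
      aemeasurable_id (by simp)
    rw [variance_id_gaussianReal] at h1
    simpa using h1.symm
  have hsol : ∀ l, 0 < l → ∃ u, IsSol ((gaussianReal 0 1).prod Fε) γ (deriv ρ) l
      (alpha l) (kappa l) u := by
    intro l hl
    obtain ⟨ha, hk, h1, h2⟩ := halpha l hl
    exact ⟨_, isSol_of_system γ ρ Mψ hρconv hρdiff hρmin hψbdd Fε (prox l (kappa l)) l
      (alpha l) (kappa l) hl ha hk hZ hZ2 (fun x v => hprox l (kappa l) x hl v) h1 h2⟩
  clear hprox halpha
  generalize hP : (gaussianReal 0 1).prod Fε = P at *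
  have hPprob : IsProbabilityMeasure P := by rw [← hP]; infer_instance
  have hPpos : P.IsOpenPosMeasure := by rw [← hP]; infer_instance
  choose! u hu using hsol
  obtain ⟨δ, hδdef⟩ : ∃ δ, δ = δ0 * lamMin := ⟨_, rfl⟩
  have hδ : 0 < δ := by rw [hδdef]; positivity
  have hscaled : ∀ l, lamMin ≤ l → ∀ s t : ℝ, |s| ≤ δ →
      c * (min |s - t| δ * |s - t|) ≤
        (l * deriv ρ (s / l) - l * deriv ρ (t / l)) * (s - t) := by
    intro l hl s t hs
    rw [hδdef] at *
    exact psi_scaled (deriv ρ) hm c δ0 hc hδ0 hstrong lamMin l hmin hl s t hs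
  let A : ℝ → Set (ℝ × ℝ) := fun a => {q | |a * q.1 + q.2| < δ ∧ 2 * δ < |q.2|}
  have hAopen : ∀ a, IsOpen (A a) := by
    intro a
    have c1 : Continuous fun q : ℝ × ℝ => |a * q.1 + q.2| := by fun_prop
    have c2 : Continuous fun q : ℝ × ℝ => |q.2| := by fun_prop
    exact (isOpen_lt c1 continuous_const).and (isOpen_lt continuous_const c2)
  have hmain : ∀ l l', lamMin ≤ l → lamMin ≤ l' →
      P.real (A (alpha l)) * (c * δ ^ 2 / 2)
        * ((alpha l - alpha l') / (alpha l + alpha l')) ^ 2 ≤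
      Ct * |l - l'| * alpha l * (1 + 2 * c * kappa l) := by
    intro l l' hl hl'
    have p1 := hmin.trans_le hl
    have p2 := hmin.trans_le hl'
    exact main_ineq hZ hm (hu l p1) (hu l' p2) Ct hCt hγ0.le (htun l l' p1 p2) c δ hc hδ
      (hscaled l hl) _ (hAopen _).measurableSet (fun q hq => hq.1.le) (fun q hq => hq.2.le)
  -- uniform bounds
  have hbound : ∃ B > 0, ∀ l ∈ Set.Icc lamMin lamMax, alpha l ≤ B ∧ kappa l ≤ B ∧
      B⁻¹ ≤ P.real (A (alpha l)) := by
    refine (isCompact_Icc (a := lamMin) (b := lamMax)).induction_on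
      (p := fun s => ∃ B > 0, ∀ l ∈ s, alpha l ≤ B ∧ kappa l ≤ B ∧ B⁻¹ ≤ P.real (A (alpha l)))
      ?_ ?_ ?_ ?_
    · exact ⟨1, one_pos, fun l hl => by simp at hl⟩
    · rintro s t hst ⟨B, hB, h⟩
      exact ⟨B, hB, fun l hl => h l (hst hl)⟩
    · rintro s t ⟨B, hB, h⟩ ⟨B', hB', h'⟩
      refine ⟨max B B', lt_max_of_lt_left hB, fun l hl => ?_⟩
      rcases hl with hl | hl
      · obtain ⟨x, y, z⟩ := h l hl
        exact ⟨x.trans (le_max_left _ _), y.trans (le_max_left _ _),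
          (inv_anti₀ hB (le_max_left _ _)).trans z⟩
      · obtain ⟨x, y, z⟩ := h' l hl
        exact ⟨x.trans (le_max_right _ _), y.trans (le_max_right _ _),
          (inv_anti₀ hB' (le_max_right _ _)).trans z⟩
    · intro l0 hl0
      have p0 : 0 < l0 := hmin.trans_le hl0.1
      have ha0 := (hu l0 p0).ha
      have hk0 := (hu l0 p0).hk
      -- the reference event
      have hR : 0 < 3 * δ / alpha l0 + 1 := by positivity
      obtain ⟨R, hRdef⟩ : ∃ R, R = 3 * δ / alpha l0 + 1 := ⟨_, rfl⟩
      rw [← hRdef] at hR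
      let A0 : Set (ℝ × ℝ) :=
        {q | (|alpha l0 * q.1 + q.2| < δ / 2 ∧ 2 * δ < |q.2|) ∧ |q.1| < R}
      have hA0open : IsOpen A0 := by
        have c1 : Continuous fun q : ℝ × ℝ => |alpha l0 * q.1 + q.2| := by fun_prop
        have c2 : Continuous fun q : ℝ × ℝ => |q.2| := by fun_prop
        have c3 : Continuous fun q : ℝ × ℝ => |q.1| := by fun_prop
        exact ((isOpen_lt c1 continuous_const).and (isOpen_lt continuous_const c2)).and
          (isOpen_lt c3 continuous_const)
      have hA0ne : A0.Nonempty := by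
        refine ⟨(-(3 * δ / alpha l0), 3 * δ), ⟨⟨?_, ?_⟩, ?_⟩⟩
        · have : alpha l0 * -(3 * δ / alpha l0) + 3 * δ = 0 := by field_simp; ring
          simp only [this, abs_zero]
          positivity
        · simp only
          rw [abs_of_pos (by positivity)]
          linarith
        · simp only [abs_neg]
          rw [abs_of_pos (by positivity), hRdef]
          linarith
      have hA0pos : 0 < P.real A0 := by
        have := hA0open.measure_pos P hA0ne
        exact ENNReal.toReal_pos this.ne' (measure_ne_top _ _)
      have hA0sub : A0 ⊆ A (alpha l0) := fun q hq => ⟨hq.1.1.trans (by linarith), hq.1.2⟩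
      have hPA : 0 < P.real (A (alpha l0)) := hA0pos.trans_le (measureReal_mono hA0sub)
      have hmem : ∀ᶠ l in nhdsWithin l0 (Set.Icc lamMin lamMax), l ∈ Set.Icc lamMin lamMax :=
        self_mem_nhdsWithin
      have hdl : Tendsto (fun l => |l0 - l|) (nhdsWithin l0 (Set.Icc lamMin lamMax)) (nhds 0) := by
        have : Continuous fun l => |l0 - l| := by fun_prop
        have h := (this.tendsto l0).mono_left (nhdsWithin_le_nhds (s := Set.Icc lamMin lamMax))
        simpa using h
      have hy : Tendsto (fun l => (alpha l0 - alpha l) / (alpha l0 + alpha l))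
          (nhdsWithin l0 (Set.Icc lamMin lamMax)) (nhds 0) := by
        have hK : 0 < P.real (A (alpha l0)) * (c * δ ^ 2 / 2) := by positivity
        have hub : Tendsto (fun l => (Ct * |l0 - l| * alpha l0 * (1 + 2 * c * kappa l0)) /
            (P.real (A (alpha l0)) * (c * δ ^ 2 / 2)))
            (nhdsWithin l0 (Set.Icc lamMin lamMax)) (nhds 0) := by
          have := (((hdl.const_mul Ct).mul_const (alpha l0)).mul_const
            (1 + 2 * c * kappa l0)).div_const (P.real (A (alpha l0)) * (c * δ ^ 2 / 2))
          simpa using this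
        have hsq : Tendsto (fun l => ((alpha l0 - alpha l) / (alpha l0 + alpha l)) ^ 2)
            (nhdsWithin l0 (Set.Icc lamMin lamMax)) (nhds 0) := by
          refine squeeze_zero' (Eventually.of_forall fun l => sq_nonneg _) ?_ hub
          filter_upwards [hmem] with l hl
          rw [le_div_iff₀ hK, mul_comm]
          exact hmain l0 l hl0.1 hl.1
        have := hsq.sqrt
        simp only [Real.sqrt_sq_eq_abs, Real.sqrt_zero] at this
        exact (tendsto_zero_iff_abs_tendsto_zero _).2 this
      have hal : Tendsto alpha (nhdsWithin l0 (Set.Icc lamMin lamMax)) (nhds (alpha l0)) := by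
        have h1 : Tendsto (fun l => alpha l0 * (1 - (alpha l0 - alpha l) / (alpha l0 + alpha l))
            / (1 + (alpha l0 - alpha l) / (alpha l0 + alpha l)))
            (nhdsWithin l0 (Set.Icc lamMin lamMax)) (nhds (alpha l0)) := by
          have := ((hy.const_sub 1).const_mul (alpha l0)).div (hy.const_add 1) (by norm_num)
          simp only [sub_zero, mul_one, add_zero, div_one] at this
          exact this
        refine h1.congr' ?_
        filter_upwards [hmem] with l hl
        have ha := (hu l (hmin.trans_le hl.1)).ha
        have e1 : 1 - (alpha l0 - alpha l) / (alpha l0 + alpha l)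
          = 2 * alpha l / (alpha l0 + alpha l) := by field_simp; ring
        have e2 : 1 + (alpha l0 - alpha l) / (alpha l0 + alpha l)
          = 2 * alpha l0 / (alpha l0 + alpha l) := by field_simp; ring
        rw [e1, e2]
        field_simp
      have hX : Tendsto (fun l => 4 * (Ct * |l0 - l|) ^ 2 + 4 * ((1 - γ) * (alpha l0 - alpha l) ^ 2
          + 2 * (kappa l0 * (Ct * |l0 - l| * (alpha l0 + alpha l)))))
          (nhdsWithin l0 (Set.Icc lamMin lamMax)) (nhds 0) := by
        have h1 := ((hdl.const_mul Ct).pow 2).const_mul 4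
        have h2 := ((hal.const_sub (alpha l0)).pow 2).const_mul (1 - γ)
        have h3 := (((hdl.const_mul Ct).mul (hal.const_add (alpha l0))).const_mul
          (kappa l0)).const_mul 2
        have := h1.add ((h2.add h3).const_mul 4)
        simpa using this
      have ev1 := hX.eventually (gt_mem_nhds
        (show 0 < (alpha l0) ^ 2 * γ / kappa l0 ^ 2 / 2 by positivity))
      have ev2 := hal.eventually (gt_mem_nhds (show alpha l0 < 2 * alpha l0 by linarith))
      have ev3 : ∀ᶠ l in nhdsWithin l0 (Set.Icc lamMin lamMax),
          |alpha l - alpha l0| * R < δ / 2 := by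
        have h1 : Tendsto (fun l => |alpha l - alpha l0| * R)
            (nhdsWithin l0 (Set.Icc lamMin lamMax)) (nhds 0) := by
          have := ((hal.sub_const (alpha l0)).abs).mul_const R
          simpa using this
        exact h1.eventually (gt_mem_nhds (by positivity))
      refine ⟨{l | alpha l ≤ 2 * alpha l0 ∧ kappa l ≤ 4 * kappa l0 ∧
        P.real A0 ≤ P.real (A (alpha l))}, ?_, ?_⟩
      · filter_upwards [hmem, ev1, ev2, ev3] with l hl e1 e2 e3
        have pl : 0 < l := hmin.trans_le hl.1
        have hul := hu l pl
        have ha := hul.ha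
        have hk := hul.hk
        refine ⟨e2.le, ?_, ?_⟩
        · have h1 := kappa_ineq hZ hZ2 hψlip (hu l0 p0) hul Ct (htun l0 l p0 pl)
          have h2 := defect_le hZ hm (hu l0 p0) hul Ct hCt hγ0.le (htun l0 l p0 pl)
          have h3 : alpha l0 ^ 2 * γ / kappa l0 ^ 2 / 2 ≤
              2 * (alpha l ^ 2 * γ / kappa l ^ 2) := by linarith
          have h4 : 2 * (alpha l ^ 2 * γ / kappa l ^ 2) ≤
              2 * ((2 * alpha l0) ^ 2 * γ / kappa l ^ 2) := by gcongr
          have h5 := h3.trans h4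
          have h6 : alpha l0 ^ 2 * γ * kappa l ^ 2 ≤ alpha l0 ^ 2 * γ * (4 * kappa l0) ^ 2 := by
            rw [div_div, mul_div_assoc', div_le_div_iff₀ (by positivity) (by positivity)] at h5
            linarith
          have h7 := le_of_mul_le_mul_left h6 (by positivity)
          exact le_of_sq_le_sq h7 (by positivity)
        · refine measureReal_mono fun q hq => ⟨?_, hq.1.2⟩
          have : alpha l * q.1 + q.2 = (alpha l0 * q.1 + q.2) + (alpha l - alpha l0) * q.1 := by
            ring
          rw [this]
          refine (abs_add_le _ _).trans_lt ?_
          rw [abs_mul]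
          have h1 : |alpha l - alpha l0| * |q.1| ≤ |alpha l - alpha l0| * R := by
            have := hq.2.le
            gcongr
          linarith [hq.1.1]
      · refine ⟨max (max (2 * alpha l0) (4 * kappa l0)) (P.real A0)⁻¹,
          lt_max_of_lt_right (by positivity), fun l hl => ⟨?_, ?_, ?_⟩⟩
        · exact hl.1.trans ((le_max_left _ _).trans (le_max_left _ _))
        · exact hl.2.1.trans ((le_max_right _ _).trans (le_max_left _ _))
        · exact (inv_le_of_inv_le₀ hA0pos (le_max_right _ _)).trans hl.2.2
  obtain ⟨B, hB, hbd⟩ := hbound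
  obtain ⟨K, hKdef⟩ : ∃ K, K = (Ct * B * (1 + 2 * c * B)) / (B⁻¹ * (c * δ ^ 2 / 2)) := ⟨_, rfl⟩
  have hK : 0 ≤ K := by rw [hKdef]; positivity
  refine ⟨Real.sqrt (K * (2 * B) ^ 4), fun l l' hl hl' => ?_⟩
  have hul := hu l (hmin.trans_le hl.1)
  have hul' := hu l' (hmin.trans_le hl'.1)
  have ha := hul.ha
  have ha' := hul'.ha
  have hk := hul.hk
  obtain ⟨b1, b2, b3⟩ := hbd l hl
  obtain ⟨b1', -, -⟩ := hbd l' hl'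
  have h1 := hmain l l' hl.1 hl'.1
  have h2 : ((alpha l - alpha l') / (alpha l + alpha l')) ^ 2 ≤ K * |l - l'| := by
    rw [hKdef, div_mul_eq_mul_div, le_div_iff₀ (by positivity)]
    calc _ = B⁻¹ * (c * δ ^ 2 / 2) * ((alpha l - alpha l') / (alpha l + alpha l')) ^ 2 := by ring
      _ ≤ P.real (A (alpha l)) * (c * δ ^ 2 / 2)
        * ((alpha l - alpha l') / (alpha l + alpha l')) ^ 2 := by gcongr
      _ ≤ _ := h1
      _ ≤ Ct * |l - l'| * B * (1 + 2 * c * B) := by gcongr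
      _ = _ := by ring
  rw [← Real.sqrt_mul (by positivity)]
  apply Real.abs_le_sqrt
  have e : (alpha l ^ 2 - alpha l' ^ 2) ^ 2 =
      ((alpha l - alpha l') / (alpha l + alpha l')) ^ 2 * (alpha l + alpha l') ^ 4 := by
    field_simp
    ring
  rw [e]
  calc _ ≤ (K * |l - l'|) * (2 * B) ^ 4 := by
        gcongr
        linarith
    _ = _ := by ring
end

section
/- Let 𝓛: ℝ^p → ℝ be a convex function, let μ > 0, let ĥ be a minimizer of 𝓛 over ℝ^p, and let ĥ_μ be a minimizer of h ↦ 𝓛(h) + (μ/2)‖h‖² over ℝ^p. Then ‖ĥ − ĥ_μ‖² ≤ ‖ĥ‖² − ‖ĥ_μ‖². -/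
/-- If `ĥ` minimizes a convex `𝓛 : ℝ^p → ℝ` and `ĥ_μ` minimizes
`h ↦ 𝓛(h) + (μ/2)‖h‖²` with `μ > 0`, then `‖ĥ − ĥ_μ‖² ≤ ‖ĥ‖² − ‖ĥ_μ‖²`. -/
theorem ridge_smoothing_norm_inequality
    (p : ℕ) (L : EuclideanSpace ℝ (Fin p) → ℝ)
    (hL : ConvexOn ℝ Set.univ L)
    (μ : ℝ) (hμ : 0 < μ)
    (hhat hmu : EuclideanSpace ℝ (Fin p))
    (hhat_min : ∀ h : EuclideanSpace ℝ (Fin p), L hhat ≤ L h)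
    (hmu_min : ∀ h : EuclideanSpace ℝ (Fin p),
      L hmu + (μ / 2) * ‖hmu‖ ^ 2 ≤ L h + (μ / 2) * ‖h‖ ^ 2) :
    ‖hhat - hmu‖ ^ 2 ≤ ‖hhat‖ ^ 2 - ‖hmu‖ ^ 2 := by
  have key : ∀ t : ℝ, 0 < t → t ≤ 1 →
      0 ≤ 2 * inner ℝ hmu (hhat - hmu) + t * ‖hhat - hmu‖ ^ 2 := by
    intro t ht0 ht1
    have hc := hL.2 (Set.mem_univ hmu) (Set.mem_univ hhat)
      (sub_nonneg.2 ht1) ht0.le (by ring)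
    have he : (1 - t) • hmu + t • hhat = hmu + t • (hhat - hmu) := by
      module
    rw [he] at hc
    simp only [smul_eq_mul] at hc
    have h1 := hmu_min (hmu + t • (hhat - hmu))
    have h2 := hhat_min hmu
    have hn := norm_add_sq_real hmu (t • (hhat - hmu))
    rw [inner_smul_right, norm_smul, mul_pow, Real.norm_eq_abs, sq_abs] at hn
    have h3 : t * L hhat ≤ t * L hmu := mul_le_mul_of_nonneg_left h2 ht0.le
    have h4 : (μ / 2) * ‖hmu‖ ^ 2 ≤ (μ / 2) * ‖hmu + t • (hhat - hmu)‖ ^ 2 := by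
      linarith
    have h5 := le_of_mul_le_mul_left h4 (by positivity)
    rw [hn] at h5
    refine le_of_mul_le_mul_left ?_ ht0
    linarith
  have hn := norm_add_sq_real hmu (hhat - hmu)
  rw [add_sub_cancel] at hn
  have hN : 0 ≤ ‖hhat - hmu‖ ^ 2 := by positivity
  generalize ‖hhat - hmu‖ ^ 2 = N at *
  generalize inner ℝ hmu (hhat - hmu) = I at *
  have hI : 0 ≤ I := by
    by_contra! hneg
    have hpos : 0 < N - I := by linarith
    have h := key (-I / (N - I)) (div_pos (by linarith) hpos)
      ((div_le_one hpos).2 (by linarith))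
    have h6 : -I / (N - I) * N ≤ -I := by
      rw [div_mul_eq_mul_div, div_le_iff₀ hpos]
      nlinarith
    linarith
  linarith
end

section
/- Let ψ: ℝ → ℝ be 1-Lipschitz and nondecreasing (acting componentwise on vectors), let G ∈ ℝ^{n×p}, ε ∈ ℝ^n, μ > 0, and let ĥ, ĥ_μ ∈ ℝ^p satisfy the first-order conditions Gᵀψ(ε − Gĥ) = 0 and Gᵀψ(ε − Gĥ_μ) = nμ ĥ_μ. Then ‖ψ(ε − Gĥ_μ) − ψ(ε − Gĥ)‖² ≤ nμ ‖ĥ_μ‖ ‖ĥ − ĥ_μ‖. -/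
open Matrix

/-- For `ψ : ℝ → ℝ` 1-Lipschitz and nondecreasing acting
componentwise, if `Gᵀψ(ε − Gĥ) = 0` and `Gᵀψ(ε − Gĥ_μ) = nμĥ_μ` (the KKT
conditions), then `‖ψ(ε − Gĥ_μ) − ψ(ε − Gĥ)‖² ≤ nμ‖ĥ_μ‖‖ĥ − ĥ_μ‖`. -/
theorem psi_difference_bound_from_KKT
    (ψ : ℝ → ℝ) (hlip : LipschitzWith 1 ψ) (hmono : Monotone ψ)
    (n p : ℕ) (G : Matrix (Fin n) (Fin p) ℝ) (ε : Fin n → ℝ)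
    (μ : ℝ) (hμ : 0 < μ)
    (hhat hmu : Fin p → ℝ)
    (hKKT : Gᵀ *ᵥ (fun i => ψ (ε i - (G *ᵥ hhat) i)) = 0)
    (hKKTmu : Gᵀ *ᵥ (fun i => ψ (ε i - (G *ᵥ hmu) i)) = (n : ℝ) • μ • hmu) :
    ∑ i, (ψ (ε i - (G *ᵥ hmu) i) - ψ (ε i - (G *ᵥ hhat) i)) ^ 2
      ≤ (n : ℝ) * μ * Real.sqrt (∑ j, (hmu j) ^ 2)
          * Real.sqrt (∑ j, (hhat j - hmu j) ^ 2) := by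
  have key : ∀ a b : ℝ, (ψ a - ψ b) ^ 2 ≤ (ψ a - ψ b) * (a - b) := by
    intro a b
    have hd := hlip.dist_le_mul a b
    simp only [Real.dist_eq, NNReal.coe_one, one_mul] at hd
    rcases le_total a b with h | h
    · have h1 := hmono h
      rw [abs_of_nonpos (by linarith), abs_of_nonpos (by linarith)] at hd
      nlinarith
    · have h1 := hmono h
      rw [abs_of_nonneg (by linarith), abs_of_nonneg (by linarith)] at hd
      nlinarith
  have hid : ∀ u : Fin n → ℝ, u ⬝ᵥ (G *ᵥ (hhat - hmu)) = (Gᵀ *ᵥ u) ⬝ᵥ (hhat - hmu) := by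
    intro u
    rw [Matrix.dotProduct_mulVec, Matrix.mulVec_transpose]
  have e1 := hid (fun i => ψ (ε i - (G *ᵥ hmu) i))
  have e2 := hid (fun i => ψ (ε i - (G *ᵥ hhat) i))
  rw [hKKTmu, Matrix.mulVec_sub] at e1
  rw [hKKT, Matrix.mulVec_sub, zero_dotProduct] at e2
  rw [smul_dotProduct, smul_dotProduct] at e1
  simp only [dotProduct, Pi.sub_apply, smul_eq_mul] at e1 e2
  have cs := Real.sum_mul_le_sqrt_mul_sqrt Finset.univ hmu (fun j => hhat j - hmu j)
  calc ∑ i, (ψ (ε i - (G *ᵥ hmu) i) - ψ (ε i - (G *ᵥ hhat) i)) ^ 2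
      ≤ ∑ i, (ψ (ε i - (G *ᵥ hmu) i) - ψ (ε i - (G *ᵥ hhat) i))
          * ((ε i - (G *ᵥ hmu) i) - (ε i - (G *ᵥ hhat) i)) :=
        Finset.sum_le_sum fun i _ => key _ _
    _ = ∑ i, ψ (ε i - (G *ᵥ hmu) i) * ((G *ᵥ hhat) i - (G *ᵥ hmu) i)
        - ∑ i, ψ (ε i - (G *ᵥ hhat) i) * ((G *ᵥ hhat) i - (G *ᵥ hmu) i) := by
        rw [← Finset.sum_sub_distrib]
        exact Finset.sum_congr rfl fun i _ => by ring
    _ = (n : ℝ) * μ * ∑ j, hmu j * (hhat j - hmu j) := by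
        rw [e1, e2]; ring
    _ ≤ (n : ℝ) * μ * (Real.sqrt (∑ j, (hmu j) ^ 2)
          * Real.sqrt (∑ j, (hhat j - hmu j) ^ 2)) :=
        mul_le_mul_of_nonneg_left cs (by positivity)
    _ = _ := by ring
end
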